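/- arXiv:math/0701338 — 10 statements merged into one kernel-verified Lean document; each statement's English description precedes it below -/
import Mathlib

section
/- Let F be a field of characteristic different from 2 and a, b, c, d, x ∈ F. Suppose A(a, b, x) = 0 and A(c, d, x) = 0, where A is Archimedes' function. Then ((a + b + c + d)² − 2(a² + b² + c² + d²))² = 64abcd. Furthermore, if a + b ≠ c + d then x = ((a − b)² − (c − d)²) / (2(a + b − c − d)). -/
/-- Archimedes' function. -/
def archimedes {F : Type*} [Field F] (a b c : F) : F :=
  (a + b + c) ^ 2 - 2 * (a ^ 2 + b ^ 2 + c ^ 2)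

theorem two_quad_triples {F : Type*} [Field F] (h2 : (2 : F) ≠ 0)
    (a b c d x : F) (hab : archimedes a b x = 0) (hcd : archimedes c d x = 0) :
    ((a + b + c + d) ^ 2 - 2 * (a ^ 2 + b ^ 2 + c ^ 2 + d ^ 2)) ^ 2 = 64 * a * b * c * d ∧
    (a + b ≠ c + d →
      x = ((a - b) ^ 2 - (c - d) ^ 2) / (2 * (a + b - c - d))) := by
  unfold archimedes at hab hcd
  have hu : (x - (a + b)) ^ 2 = 4 * (a * b) := by linear_combination -hab
  have hv : (x - (c + d)) ^ 2 = 4 * (c * d) := by linear_combination -hcd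
  refine ⟨?_, fun h => ?_⟩
  · have hE : (a + b + c + d) ^ 2 - 2 * (a ^ 2 + b ^ 2 + c ^ 2 + d ^ 2) =
        2 * ((x - (a + b)) * (x - (c + d))) := by
      linear_combination -hu - hv
    rw [hE, mul_pow, mul_pow, hu, hv]
    ring
  · have hs : a + b - c - d ≠ 0 := fun h0 => h (by linear_combination h0)
    rw [eq_div_iff (mul_ne_zero h2 hs)]
    linear_combination hab - hcd
end

section
/- Let F be a field of characteristic different from 2 and let x1, x2, x3, x4 ∈ F. Define Qij := (xj − xi)² for i, j ∈ {1,2,3,4}. Then Q(Q12, Q23, Q34, Q14) = 0, where Q is the Quadruple quad function. Furthermore, Q13 = ((Q12 − Q23)² − (Q34 − Q14)²) / (2(Q12 + Q23 − Q34 − Q14)) provided 2(Q12 + Q23 − Q34 − Q14) ≠ 0, and Q24 = ((Q23 − Q34)² − (Q12 − Q14)²) / (2(Q23 + Q34 − Q12 − Q14)) provided 2(Q23 + Q34 − Q12 − Q14) ≠ 0. -/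
/-- The Quadruple quad function. -/
def quadrupleQuad {F : Type*} [Field F] (a b c d : F) : F :=
  ((a + b + c + d) ^ 2 - 2 * (a ^ 2 + b ^ 2 + c ^ 2 + d ^ 2)) ^ 2 - 64 * a * b * c * d

theorem quadruple_quad_formula {F : Type*} [Field F] (h2 : (2 : F) ≠ 0)
    (x1 x2 x3 x4 : F)
    (Q12 Q13 Q14 Q23 Q24 Q34 : F)
    (hQ12 : Q12 = (x2 - x1) ^ 2) (hQ13 : Q13 = (x3 - x1) ^ 2) (hQ14 : Q14 = (x4 - x1) ^ 2)
    (hQ23 : Q23 = (x3 - x2) ^ 2) (hQ24 : Q24 = (x4 - x2) ^ 2) (hQ34 : Q34 = (x4 - x3) ^ 2) :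
    quadrupleQuad Q12 Q23 Q34 Q14 = 0 ∧
    (2 * (Q12 + Q23 - Q34 - Q14) ≠ 0 →
      Q13 = ((Q12 - Q23) ^ 2 - (Q34 - Q14) ^ 2) / (2 * (Q12 + Q23 - Q34 - Q14))) ∧
    (2 * (Q23 + Q34 - Q12 - Q14) ≠ 0 →
      Q24 = ((Q23 - Q34) ^ 2 - (Q12 - Q14) ^ 2) / (2 * (Q23 + Q34 - Q12 - Q14))) := by
  subst hQ12 hQ13 hQ14 hQ23 hQ24 hQ34
  refine ⟨?_, fun h => ?_, fun h => ?_⟩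
  · unfold quadrupleQuad
    ring
  · rw [eq_div_iff h]
    ring
  · rw [eq_div_iff h]
    ring
end

section
/- Let F be a field of characteristic different from 2 and let d12, d23, d34, d14 ∈ F. Set D12 := d12², D23 := d23², D34 := d34², D14 := d14². Then Q(D12, D23, D34, D14) = (d12 − d14 + d23 + d34)(d12 + d14 + d23 − d34)(d14 − d12 + d23 + d34)(d12 + d14 − d23 + d34)(d12 + d14 + d23 + d34)(d12 − d14 − d23 + d34)(d12 − d14 + d23 − d34)(d23 − d14 − d12 + d34), where Q is the Quadruple quad function. -/
theorem brahmagupta_identity {F : Type*} [Field F] (h2 : (2 : F) ≠ 0)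
    (d12 d23 d34 d14 : F) (D12 D23 D34 D14 : F)
    (hD12 : D12 = d12 ^ 2) (hD23 : D23 = d23 ^ 2) (hD34 : D34 = d34 ^ 2) (hD14 : D14 = d14 ^ 2) :
    quadrupleQuad D12 D23 D34 D14 =
      (d12 - d14 + d23 + d34) * (d12 + d14 + d23 - d34) * (d14 - d12 + d23 + d34) *
      (d12 + d14 - d23 + d34) * (d12 + d14 + d23 + d34) * (d12 - d14 - d23 + d34) *
      (d12 - d14 + d23 - d34) * (d23 - d14 - d12 + d34) := by
  subst hD12 hD23 hD34 hD14
  unfold quadrupleQuad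
  ring
end

section
/- Let F be a field of characteristic different from 2 and let σ : F → F be a function satisfying (σ(x) − σ(y))² = (x − y)² for all x, y ∈ F. Then there exists α ∈ F such that either σ(x) = x + α for all x ∈ F, or σ(x) = α − x for all x ∈ F. -/
theorem affine_isometry_classification {F : Type*} [Field F] (h2 : (2 : F) ≠ 0)
    (σ : F → F) (hσ : ∀ x y : F, (σ x - σ y) ^ 2 = (x - y) ^ 2) :
    ∃ α : F, (∀ x : F, σ x = x + α) ∨ (∀ x : F, σ x = α - x) := by
  have hmul (x : F) : (σ x - σ 0) * (σ 1 - σ 0) = x := by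
    apply mul_left_cancel₀ h2
    linear_combination hσ x 0 + hσ 1 0 - hσ x 1
  have hone : (σ 1 - σ 0) ^ 2 = 1 := by simpa using hσ 1 0
  refine ⟨σ 0, (sq_eq_one_iff.mp hone).imp ?_ ?_⟩
  · intro h x
    linear_combination hmul x - (σ x - σ 0) * h
  · intro h x
    linear_combination (σ x - σ 0) * h - hmul x
end

section
/- Fix a field F of characteristic different from 2 and d, e, f ∈ F with df − e² ≠ 0. Let (x1, y1), (x2, y2) ∈ F² be non-null representatives, i.e. d x1² + 2e x1 y1 + f y1² ≠ 0 and d x2² + 2e x2 y2 + f y2² ≠ 0. Then q((x1, y1), (x2, y2)) = 1 if and only if d x1 x2 + e x1 y2 + e x2 y1 + f y1 y2 = 0. -/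
/-- The projective quadrance with respect to the form (d : e : f). -/
def projQuadrance {F : Type*} [Field F] (d e f x1 y1 x2 y2 : F) : F :=
  (d * f - e ^ 2) * (x1 * y2 - x2 * y1) ^ 2 /
    ((d * x1 ^ 2 + 2 * e * x1 * y1 + f * y1 ^ 2) *
      (d * x2 ^ 2 + 2 * e * x2 * y2 + f * y2 ^ 2))

theorem perpendicular_p_points {F : Type*} [Field F] (h2 : (2 : F) ≠ 0)
    (d e f : F) (hdisc : d * f - e ^ 2 ≠ 0)
    (x1 y1 x2 y2 : F)
    (h1 : d * x1 ^ 2 + 2 * e * x1 * y1 + f * y1 ^ 2 ≠ 0)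
    (h2' : d * x2 ^ 2 + 2 * e * x2 * y2 + f * y2 ^ 2 ≠ 0) :
    projQuadrance d e f x1 y1 x2 y2 = 1 ↔
      d * x1 * x2 + e * x1 * y2 + e * x2 * y1 + f * y1 * y2 = 0 := by
  have lagrange :
      (d * x1 ^ 2 + 2 * e * x1 * y1 + f * y1 ^ 2) *
          (d * x2 ^ 2 + 2 * e * x2 * y2 + f * y2 ^ 2) =
        (d * f - e ^ 2) * (x1 * y2 - x2 * y1) ^ 2 +
          (d * x1 * x2 + e * x1 * y2 + e * x2 * y1 + f * y1 * y2) ^ 2 := by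
    ring
  rw [projQuadrance, div_eq_one_iff_eq (mul_ne_zero h1 h2'), lagrange, left_eq_add,
    sq_eq_zero_iff]
end

section
/- Fix a field F of characteristic different from 2 and d, e, f ∈ F with df − e² ≠ 0. Let (x1, y1), (x2, y2), (x3, y3) ∈ F² be non-null representatives (d xi² + 2e xi yi + f yi² ≠ 0 for i = 1, 2, 3). Define q1 := q((x2, y2), (x3, y3)), q2 := q((x1, y1), (x3, y3)), q3 := q((x1, y1), (x2, y2)). Then (q1 + q2 + q3)² = 2(q1² + q2² + q3²) + 4 q1 q2 q3. -/
/-- The polynomial identity behind the triple quad formula, with denominators cleared. -/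
theorem projQuadrance_numerator_identity {F : Type*} [CommRing F] (d e f x1 y1 x2 y2 x3 y3 : F) :
    ((x2 * y3 - x3 * y2) ^ 2 * (d * x1 ^ 2 + 2 * e * x1 * y1 + f * y1 ^ 2) +
      (x1 * y3 - x3 * y1) ^ 2 * (d * x2 ^ 2 + 2 * e * x2 * y2 + f * y2 ^ 2) +
      (x1 * y2 - x2 * y1) ^ 2 * (d * x3 ^ 2 + 2 * e * x3 * y3 + f * y3 ^ 2)) ^ 2 =
    2 * (((x2 * y3 - x3 * y2) ^ 2 * (d * x1 ^ 2 + 2 * e * x1 * y1 + f * y1 ^ 2)) ^ 2 +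
      ((x1 * y3 - x3 * y1) ^ 2 * (d * x2 ^ 2 + 2 * e * x2 * y2 + f * y2 ^ 2)) ^ 2 +
      ((x1 * y2 - x2 * y1) ^ 2 * (d * x3 ^ 2 + 2 * e * x3 * y3 + f * y3 ^ 2)) ^ 2) +
    4 * (d * f - e ^ 2) *
      ((x2 * y3 - x3 * y2) * (x1 * y3 - x3 * y1) * (x1 * y2 - x2 * y1)) ^ 2 := by
  ring

theorem projective_triple_quad_formula {F : Type*} [Field F] (h2 : (2 : F) ≠ 0)
    (d e f : F) (hdisc : d * f - e ^ 2 ≠ 0)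
    (x1 y1 x2 y2 x3 y3 : F)
    (h1 : d * x1 ^ 2 + 2 * e * x1 * y1 + f * y1 ^ 2 ≠ 0)
    (h2' : d * x2 ^ 2 + 2 * e * x2 * y2 + f * y2 ^ 2 ≠ 0)
    (h3 : d * x3 ^ 2 + 2 * e * x3 * y3 + f * y3 ^ 2 ≠ 0)
    (q1 q2 q3 : F)
    (hq1 : q1 = projQuadrance d e f x2 y2 x3 y3)
    (hq2 : q2 = projQuadrance d e f x1 y1 x3 y3)
    (hq3 : q3 = projQuadrance d e f x1 y1 x2 y2) :
    (q1 + q2 + q3) ^ 2 = 2 * (q1 ^ 2 + q2 ^ 2 + q3 ^ 2) + 4 * q1 * q2 * q3 := by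
  have key := projQuadrance_numerator_identity d e f x1 y1 x2 y2 x3 y3
  subst hq1 hq2 hq3
  unfold projQuadrance
  generalize d * x1 ^ 2 + 2 * e * x1 * y1 + f * y1 ^ 2 = n1 at *
  generalize d * x2 ^ 2 + 2 * e * x2 * y2 + f * y2 ^ 2 = n2 at *
  generalize d * x3 ^ 2 + 2 * e * x3 * y3 + f * y3 ^ 2 = n3 at *
  generalize x2 * y3 - x3 * y2 = u at *
  generalize x1 * y3 - x3 * y1 = v at *
  generalize x1 * y2 - x2 * y1 = w at *
  generalize d * f - e ^ 2 = D at *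
  field_simp
  linear_combination key
end

section
/- Let F be a field of characteristic different from 2 and a, b, c, d, x ∈ F. Suppose S(a, b, x) = 0 and S(c, d, x) = 0, where S is the Triple spread function. Then ((a + b + c + d)² − 2(a² + b² + c² + d²) − 4(abc + abd + acd + bcd) + 8abcd)² = 64abcd(1 − a)(1 − b)(1 − c)(1 − d). Furthermore, if a + b − 2ab ≠ c + d − 2cd then x = ((a − b)² − (c − d)²) / (2(a + b − c − d − 2ab + 2cd)). -/
/-- The Triple spread function. -/
def tripleSpread {F : Type*} [Field F] (a b c : F) : F :=
  (a + b + c) ^ 2 - 2 * (a ^ 2 + b ^ 2 + c ^ 2) - 4 * a * b * c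

theorem tripleSpread_discriminant {F : Type*} [Field F] (a b x : F) :
    4 * a * b * (1 - a) * (1 - b) = (x - (a + b - 2 * a * b)) ^ 2 + tripleSpread a b x := by
  unfold tripleSpread
  ring

theorem two_spread_triples {F : Type*} [Field F] (h2 : (2 : F) ≠ 0)
    (a b c d x : F) (hab : tripleSpread a b x = 0) (hcd : tripleSpread c d x = 0) :
    ((a + b + c + d) ^ 2 - 2 * (a ^ 2 + b ^ 2 + c ^ 2 + d ^ 2) -
        4 * (a * b * c + a * b * d + a * c * d + b * c * d) + 8 * a * b * c * d) ^ 2 =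
      64 * a * b * c * d * (1 - a) * (1 - b) * (1 - c) * (1 - d) ∧
    (a + b - 2 * a * b ≠ c + d - 2 * c * d →
      x = ((a - b) ^ 2 - (c - d) ^ 2) /
        (2 * (a + b - c - d - 2 * a * b + 2 * c * d))) := by
  constructor
  · have hlhs : (a + b + c + d) ^ 2 - 2 * (a ^ 2 + b ^ 2 + c ^ 2 + d ^ 2) -
        4 * (a * b * c + a * b * d + a * c * d + b * c * d) + 8 * a * b * c * d =
        2 * (x - (a + b - 2 * a * b)) * (x - (c + d - 2 * c * d)) := by
      unfold tripleSpread at hab hcd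
      linear_combination hab + hcd
    have hrhs : 64 * a * b * c * d * (1 - a) * (1 - b) * (1 - c) * (1 - d) =
        4 * (4 * a * b * (1 - a) * (1 - b)) * (4 * c * d * (1 - c) * (1 - d)) := by
      ring
    rw [hlhs, hrhs, tripleSpread_discriminant a b x, tripleSpread_discriminant c d x, hab, hcd]
    ring
  · intro hne
    have hden : a + b - c - d - 2 * a * b + 2 * c * d ≠ 0 := fun h =>
      hne (by linear_combination h)
    rw [eq_div_iff (mul_ne_zero h2 hden)]
    unfold tripleSpread at hab hcd
    linear_combination hab - hcd
end

section
/- Fix a field F of characteristic different from 2 and d, e, f ∈ F with df − e² ≠ 0. Let (x1, y1), (x2, y2), (x3, y3), (x4, y4) ∈ F² be non-null representatives (d xi² + 2e xi yi + f yi² ≠ 0 for i = 1, 2, 3, 4), and define qij := q((xi, yi), (xj, yj)). Then R(q12, q23, q34, q14) = 0, where R is the Quadruple spread function. Furthermore, q13 = ((q12 − q23)² − (q34 − q14)²) / (2(q12 + q23 − q34 − q14 − 2 q12 q23 + 2 q34 q14)) and q24 = ((q23 − q34)² − (q12 − q14)²) / (2(q23 + q34 − q12 − q14 − 2 q23 q34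 + 2 q12 q14)), provided the respective denominators are nonzero. -/
/-- The Quadruple spread function. -/
def quadrupleSpread {F : Type*} [Field F] (a b c d : F) : F :=
  ((a + b + c + d) ^ 2 - 2 * (a ^ 2 + b ^ 2 + c ^ 2 + d ^ 2) -
      4 * (a * b * c + a * b * d + a * c * d + b * c * d) + 8 * a * b * c * d) ^ 2 -
    64 * a * b * c * d * (1 - a) * (1 - b) * (1 - c) * (1 - d)

/-- The triple spread relation between the projective quadrances of three non-null points. -/
theorem projQuadrance_triple {F : Type*} [Field F] (d e f x1 y1 x2 y2 x3 y3 : F)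
    (h1 : d * x1 ^ 2 + 2 * e * x1 * y1 + f * y1 ^ 2 ≠ 0)
    (h2 : d * x2 ^ 2 + 2 * e * x2 * y2 + f * y2 ^ 2 ≠ 0)
    (h3 : d * x3 ^ 2 + 2 * e * x3 * y3 + f * y3 ^ 2 ≠ 0)
    {a b x : F} (ha : a = projQuadrance d e f x1 y1 x2 y2)
    (hb : b = projQuadrance d e f x2 y2 x3 y3)
    (hx : x = projQuadrance d e f x1 y1 x3 y3) :
    x ^ 2 - 2 * (a + b - 2 * a * b) * x + (a - b) ^ 2 = 0 := by
  subst ha hb hx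
  unfold projQuadrance
  have key :
      (x1 * y3 - x3 * y1) ^ 4 * (d * x2 ^ 2 + 2 * e * x2 * y2 + f * y2 ^ 2) ^ 2 -
        2 * (x1 * y3 - x3 * y1) ^ 2 *
          ((x1 * y2 - x2 * y1) ^ 2 * (d * x3 ^ 2 + 2 * e * x3 * y3 + f * y3 ^ 2) *
              (d * x2 ^ 2 + 2 * e * x2 * y2 + f * y2 ^ 2) +
            (x2 * y3 - x3 * y2) ^ 2 * (d * x1 ^ 2 + 2 * e * x1 * y1 + f * y1 ^ 2) *
              (d * x2 ^ 2 + 2 * e * x2 * y2 + f * y2 ^ 2) -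
            2 * (d * f - e ^ 2) * (x1 * y2 - x2 * y1) ^ 2 * (x2 * y3 - x3 * y2) ^ 2) +
        ((x1 * y2 - x2 * y1) ^ 2 * (d * x3 ^ 2 + 2 * e * x3 * y3 + f * y3 ^ 2) -
          (x2 * y3 - x3 * y2) ^ 2 * (d * x1 ^ 2 + 2 * e * x1 * y1 + f * y1 ^ 2)) ^ 2 = 0 := by
    ring
  generalize d * x1 ^ 2 + 2 * e * x1 * y1 + f * y1 ^ 2 = Q1 at *
  generalize d * x2 ^ 2 + 2 * e * x2 * y2 + f * y2 ^ 2 = Q2 at *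
  generalize d * x3 ^ 2 + 2 * e * x3 * y3 + f * y3 ^ 2 = Q3 at *
  generalize x1 * y2 - x2 * y1 = A12 at *
  generalize x2 * y3 - x3 * y2 = A23 at *
  generalize x1 * y3 - x3 * y1 = A13 at *
  generalize d * f - e ^ 2 = D at *
  field_simp
  linear_combination D ^ 2 * key

theorem projQuadrance_comm {F : Type*} [Field F] (d e f x1 y1 x2 y2 : F) :
    projQuadrance d e f x1 y1 x2 y2 = projQuadrance d e f x2 y2 x1 y1 := by
  unfold projQuadrance
  congr 1 <;> ring

/-- The Quadruple spread function vanishes when two triple spread relations share a root. -/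
theorem quadrupleSpread_eq_zero {F : Type*} [Field F] {a b c d x : F}
    (h : x ^ 2 - 2 * (a + b - 2 * a * b) * x + (a - b) ^ 2 = 0)
    (h' : x ^ 2 - 2 * (c + d - 2 * c * d) * x + (c - d) ^ 2 = 0) :
    quadrupleSpread a b c d = 0 := by
  have resultant_eq_zero : ∀ B C B' C' : F, x ^ 2 + B * x + C = 0 → x ^ 2 + B' * x + C' = 0 →
      (C - C') ^ 2 + (B - B') * (B * C' - B' * C) = 0 := by
    intro B C B' C' hB hB'
    obtain rfl : C = -x ^ 2 - B * x := by linear_combination hB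
    obtain rfl : C' = -x ^ 2 - B' * x := by linear_combination hB'
    ring
  unfold quadrupleSpread
  linear_combination resultant_eq_zero (-2 * (a + b - 2 * a * b)) ((a - b) ^ 2)
    (-2 * (c + d - 2 * c * d)) ((c - d) ^ 2) (by linear_combination h) (by linear_combination h')

theorem projective_quadruple_quad_formula {F : Type*} [Field F] (h2 : (2 : F) ≠ 0)
    (d e f : F) (hdisc : d * f - e ^ 2 ≠ 0)
    (x1 y1 x2 y2 x3 y3 x4 y4 : F)
    (h1 : d * x1 ^ 2 + 2 * e * x1 * y1 + f * y1 ^ 2 ≠ 0)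
    (h2' : d * x2 ^ 2 + 2 * e * x2 * y2 + f * y2 ^ 2 ≠ 0)
    (h3 : d * x3 ^ 2 + 2 * e * x3 * y3 + f * y3 ^ 2 ≠ 0)
    (h4 : d * x4 ^ 2 + 2 * e * x4 * y4 + f * y4 ^ 2 ≠ 0)
    (q12 q13 q14 q23 q24 q34 : F)
    (hq12 : q12 = projQuadrance d e f x1 y1 x2 y2)
    (hq13 : q13 = projQuadrance d e f x1 y1 x3 y3)
    (hq14 : q14 = projQuadrance d e f x1 y1 x4 y4)
    (hq23 : q23 = projQuadrance d e f x2 y2 x3 y3)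
    (hq24 : q24 = projQuadrance d e f x2 y2 x4 y4)
    (hq34 : q34 = projQuadrance d e f x3 y3 x4 y4) :
    quadrupleSpread q12 q23 q34 q14 = 0 ∧
    (2 * (q12 + q23 - q34 - q14 - 2 * q12 * q23 + 2 * q34 * q14) ≠ 0 →
      q13 = ((q12 - q23) ^ 2 - (q34 - q14) ^ 2) /
        (2 * (q12 + q23 - q34 - q14 - 2 * q12 * q23 + 2 * q34 * q14))) ∧
    (2 * (q23 + q34 - q12 - q14 - 2 * q23 * q34 + 2 * q12 * q14) ≠ 0 →
      q24 = ((q23 - q34) ^ 2 - (q12 - q14) ^ 2) /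
        (2 * (q23 + q34 - q12 - q14 - 2 * q23 * q34 + 2 * q12 * q14))) := by
  have h123 := projQuadrance_triple d e f x1 y1 x2 y2 x3 y3 h1 h2' h3 hq12 hq23 hq13
  have h143 := projQuadrance_triple d e f x1 y1 x4 y4 x3 y3 h1 h4 h3 hq14
    (hq34.trans (projQuadrance_comm ..)) hq13
  have h234 := projQuadrance_triple d e f x2 y2 x3 y3 x4 y4 h2' h3 h4 hq23 hq34 hq24
  have h214 := projQuadrance_triple d e f x2 y2 x1 y1 x4 y4 h2' h1 h4
    (hq12.trans (projQuadrance_comm ..)) hq14 hq24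
  refine ⟨quadrupleSpread_eq_zero h123 (by linear_combination h143), fun h => ?_, fun h => ?_⟩
  · rw [eq_div_iff h]
    linear_combination h143 - h123
  · rw [eq_div_iff h]
    linear_combination h214 - h234
end

section
/- Let F be a field of characteristic different from 2 and let (x1, y1), (x2, y2) ∈ F² satisfy x1 y2 − x2 y1 ≠ 0, x1² + y1² ≠ 0, x2² + y2² ≠ 0, x1² − y1² ≠ 0, x2² − y2² ≠ 0, x1 y1 ≠ 0 and x2 y2 ≠ 0. Then 1/q^b((x1, y1), (x2, y2)) + 1/q^r((x1, y1), (x2, y2)) + 1/q^g((x1, y1), (x2, y2)) = 2. -/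
/-- The blue projective quadrance. -/
def qb {F : Type*} [Field F] (a1 a2 : F × F) : F :=
  (a1.1 * a2.2 - a2.1 * a1.2) ^ 2 /
    ((a1.1 ^ 2 + a1.2 ^ 2) * (a2.1 ^ 2 + a2.2 ^ 2))

/-- The red projective quadrance. -/
def qr {F : Type*} [Field F] (a1 a2 : F × F) : F :=
  -(a1.1 * a2.2 - a2.1 * a1.2) ^ 2 /
    ((a1.1 ^ 2 - a1.2 ^ 2) * (a2.1 ^ 2 - a2.2 ^ 2))

/-- The green projective quadrance. -/
def qg {F : Type*} [Field F] (a1 a2 : F × F) : F :=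
  -(a1.1 * a2.2 - a2.1 * a1.2) ^ 2 / (4 * a1.1 * a1.2 * a2.1 * a2.2)

/-- The blue perpendicular of a point. -/
def perpB {F : Type*} [Field F] (a : F × F) : F × F := (-a.2, a.1)

/-- The red perpendicular of a point. -/
def perpR {F : Type*} [Field F] (a : F × F) : F × F := (a.2, a.1)

/-- The green perpendicular of a point. -/
def perpG {F : Type*} [Field F] (a : F × F) : F × F := (a.1, -a.2)

theorem sum_of_inverse_quadrances {F : Type*} [Field F] (h2 : (2 : F) ≠ 0)
    (x1 y1 x2 y2 : F)
    (hcross : x1 * y2 - x2 * y1 ≠ 0)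
    (hb1 : x1 ^ 2 + y1 ^ 2 ≠ 0) (hb2 : x2 ^ 2 + y2 ^ 2 ≠ 0)
    (hr1 : x1 ^ 2 - y1 ^ 2 ≠ 0) (hr2 : x2 ^ 2 - y2 ^ 2 ≠ 0)
    (hg1 : x1 * y1 ≠ 0) (hg2 : x2 * y2 ≠ 0) :
    1 / qb (x1, y1) (x2, y2) + 1 / qr (x1, y1) (x2, y2) + 1 / qg (x1, y1) (x2, y2) = 2 := by
  simp only [qb, qr, qg, one_div_div]
  rw [div_neg, div_neg, ← sub_eq_add_neg, ← sub_eq_add_neg, ← sub_div, ← sub_div,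
    div_eq_iff (pow_ne_zero 2 hcross)]
  ring
end

section
/- Let F be a field of characteristic different from 2 and let x, y ∈ F with xy ≠ 0. Set s := −(y − x)² / (4xy). Then for every natural number n, the n-th spread polynomial satisfies S_n(s) = −(yⁿ − xⁿ)² / (4 xⁿ yⁿ). -/
/-- The spread polynomials, defined recursively. -/
def spreadPoly {F : Type*} [Field F] : ℕ → F → F
  | 0, _ => 0
  | 1, s => s
  | (n + 2), s => 2 * (1 - 2 * s) * spreadPoly (n + 1) s - spreadPoly n s + 2 * s

theorem spread_poly_values {F : Type*} [Field F] (h2 : (2 : F) ≠ 0)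
    (x y : F) (hxy : x * y ≠ 0) (s : F) (hs : s = -(y - x) ^ 2 / (4 * x * y)) :
    ∀ n : ℕ, spreadPoly n s = -(y ^ n - x ^ n) ^ 2 / (4 * x ^ n * y ^ n) := by
  have hx : x ≠ 0 := left_ne_zero_of_mul hxy
  have hy : y ≠ 0 := right_ne_zero_of_mul hxy
  have h4 : (4 : F) ≠ 0 := by
    rw [show (4 : F) = 2 * 2 by norm_num]
    exact mul_ne_zero h2 h2
  intro n
  induction n using Nat.twoStepInduction with
  | zero => simp [spreadPoly]
  | one => simpa [spreadPoly] using hs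
  | more n ih₀ ih₁ =>
    rw [spreadPoly, ih₀, ih₁, hs]
    have hxn : x ^ n ≠ 0 := pow_ne_zero n hx
    have hyn : y ^ n ≠ 0 := pow_ne_zero n hy
    simp only [pow_succ x, pow_succ y]
    generalize x ^ n = a at *
    generalize y ^ n = b at *
    field_simp
    ring
end
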